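/- Let n ≥ 4 and 2 ≤ p < log₂ n. Then 4n − 4 ≤ H'_α(ℓ_p^n) ≤ H_α(ℓ_p^n) < 2^n; in particular there is no set of 2^n points on the unit sphere of ℓ_p^n that is a bounded and separated antipodal set with constant d ≥ 1. -/

import Mathlib

open Metric

noncomputable section

/-- `S` is a bounded and separated antipodal subset of `X` with constant `d`. -/
def IsBSA {X : Type*} [NormedAddCommGroup X] [NormedSpace ℝ X] (S : Set X) (d : ℝ) : Prop :=
  S ⊆ closedBall (0 : X) 1 ∧
    ∀ x ∈ S, ∀ y ∈ S, x ≠ y → ∃ f : X →L[ℝ] ℝ, ‖f‖ ≤ 1 ∧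
      d ≤ f x - f y ∧ ∀ z ∈ S, f y ≤ f z ∧ f z ≤ f x

/-- The antipodality condition (with gap `1`). -/
def AntipProp {X : Type*} [NormedAddCommGroup X] [NormedSpace ℝ X] (S : Set X) : Prop :=
  ∀ x ∈ S, ∀ y ∈ S, x ≠ y → ∃ f : X →L[ℝ] ℝ, ‖f‖ ≤ 1 ∧
    1 ≤ f x - f y ∧ ∀ z ∈ S, f y ≤ f z ∧ f z ≤ f x

/-- The strict antipodality condition (with gap `> 1`). -/
def StrictAntipProp {X : Type*} [NormedAddCommGroup X] [NormedSpace ℝ X] (S : Set X) : Prop :=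
  ∀ x ∈ S, ∀ y ∈ S, x ≠ y → ∃ f : X →L[ℝ] ℝ, ‖f‖ ≤ 1 ∧
    1 < f x - f y ∧ ∀ z ∈ S, f y ≤ f z ∧ f z ≤ f x

/-- The antipodal Hadwiger number `H_α(X)`. -/
def Halpha (X : Type*) [NormedAddCommGroup X] [NormedSpace ℝ X] : ℕ :=
  sSup {k : ℕ | ∃ S : Finset X, S.card = k ∧ (S : Set X) ⊆ sphere (0 : X) 1 ∧
    AntipProp (S : Set X)}

/-- The strict antipodal Hadwiger number `H'_α(X)`. -/
def strictHalpha (X : Type*) [NormedAddCommGroup X] [NormedSpace ℝ X] : ℕ :=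
  sSup {k : ℕ | ∃ S : Finset X, S.card = k ∧ (S : Set X) ⊆ sphere (0 : X) 1 ∧
    StrictAntipProp (S : Set X)}

open MeasureTheory Module

section Vol

variable {E : Type*} [NormedAddCommGroup E] [NormedSpace ℝ E] [FiniteDimensional ℝ E]
  [MeasurableSpace E] [BorelSpace E] (μ : Measure E) [μ.IsAddHaarMeasure]

theorem le_on_hull {E : Type*} [NormedAddCommGroup E] [NormedSpace ℝ E]
    {S : Finset E} (f : E →L[ℝ] ℝ) {a : ℝ} (h : ∀ z ∈ S, a ≤ f z) :
    ∀ u ∈ convexHull ℝ (S : Set E), a ≤ f u := by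
  intro u hu
  exact convexHull_min (t := {u | a ≤ f u}) (fun z hz => h z hz)
    (convex_halfSpace_ge f.toLinearMap.isLinear a) hu

theorem hull_le {E : Type*} [NormedAddCommGroup E] [NormedSpace ℝ E]
    {S : Finset E} (f : E →L[ℝ] ℝ) {a : ℝ} (h : ∀ z ∈ S, f z ≤ a) :
    ∀ u ∈ convexHull ℝ (S : Set E), f u ≤ a := by
  intro u hu
  exact convexHull_min (t := {u | f u ≤ a}) (fun z hz => h z hz)
    (convex_halfSpace_le f.toLinearMap.isLinear a) hu

theorem aux_null (f : E →L[ℝ] ℝ) {e : E} (he : f e ≠ 0) (c : ℝ) : μ {u | f u = c} = 0 := by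
  have h : {u | f u = c} = ((f.toLinearMap.ker.toAffineSubspace).map
      (AffineEquiv.constVAdd ℝ E ((c / f e) • e)).toAffineMap : AffineSubspace ℝ E) := by
    ext u
    simp only [Set.mem_setOf_eq, AffineSubspace.coe_map, Set.mem_image]
    constructor
    · intro hu
      refine ⟨u - (c / f e) • e, ?_, ?_⟩
      · simp [hu, he]
      · simp
    · rintro ⟨v, hv, rfl⟩
      have : f v = 0 := by simpa using hv
      simp [this, he]
  rw [h]
  apply Measure.addHaar_affineSubspace
  intro htop
  have h2 : {u | f u = c} = (Set.univ : Set E) := by rw [h, htop]; rfl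
  have h0 : (0 : E) ∈ {u | f u = c} := by rw [h2]; trivial
  have h1 : e ∈ {u | f u = c} := by rw [h2]; trivial
  simp only [Set.mem_setOf_eq, map_zero] at h0 h1
  exact he (h1.trans h0.symm)

/-- half-size copy measure -/
theorem measure_half (x : E) (A : Set E) :
    μ {u | (2:ℝ) • u - x ∈ A} = ENNReal.ofReal ((1/2 : ℝ) ^ finrank ℝ E) * μ A := by
  have h : {u | (2:ℝ) • u - x ∈ A} = AffineMap.homothety x (1/2 : ℝ) '' A := by
    ext u
    simp only [Set.mem_setOf_eq, Set.mem_image, AffineMap.homothety_apply, vsub_eq_sub,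
      vadd_eq_add]
    constructor
    · intro hu
      refine ⟨_, hu, ?_⟩
      module
    · rintro ⟨v, hv, rfl⟩
      convert hv using 1
      module
  rw [h, Measure.addHaar_image_homothety, abs_of_nonneg (by positivity)]

/-- The tile of `conv S` at `x`. -/
def tile {E : Type*} [NormedAddCommGroup E] [NormedSpace ℝ E] (S : Finset E) (x : E) : Set E :=
  {u | (2:ℝ) • u - x ∈ convexHull ℝ (S : Set E)}

theorem tile_subset {E : Type*} [NormedAddCommGroup E] [NormedSpace ℝ E]
    {S : Finset E} {x : E} (hx : x ∈ S) : tile S x ⊆ convexHull ℝ (S : Set E) := by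
  intro u hu
  have h := (convex_convexHull ℝ (S : Set E)) hu (subset_convexHull ℝ _ (show x ∈ (S : Set E) from hx))
    (a := 1/2) (b := 1/2) (by norm_num) (by norm_num) (by norm_num)
  convert h using 1
  module

theorem tile_meas (S : Finset E) (x : E) : MeasurableSet (tile S x) := by
  have hc : IsClosed (convexHull ℝ (S : Set E)) := S.finite_toSet.isClosed_convexHull ℝ
  exact (hc.preimage (f := fun u : E => (2:ℝ) • u - x) (by fun_prop)).measurableSet

theorem tile_disj {S : Finset E} (hS : AntipProp (S : Set E)) :
    Set.Pairwise (S : Set E) (Function.onFun (AEDisjoint μ) (tile S)) := by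
  intro x hx y hy hxy
  obtain ⟨f, -, h1, h2⟩ := hS x hx y hy hxy
  have he : f (x - y) ≠ 0 := by rw [map_sub]; linarith
  refine measure_mono_null ?_ (aux_null μ f he ((f x + f y) / 2))
  rintro u ⟨hux, huy⟩
  have a1 := le_on_hull f (fun z hz => (h2 z hz).1) _ hux
  have a2 := hull_le f (fun z hz => (h2 z hz).2) _ huy
  simp only [map_sub, map_smul, smul_eq_mul] at a1 a2
  simp only [Set.mem_setOf_eq]
  linarith

theorem hull_pos {S : Finset E} (hi : (interior (convexHull ℝ (S : Set E))).Nonempty) :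
    μ (convexHull ℝ (S : Set E)) ≠ 0 :=
  ((isOpen_interior.measure_pos μ hi).trans_le (measure_mono interior_subset)).ne'

theorem hull_fin (S : Finset E) : μ (convexHull ℝ (S : Set E)) ≠ ⊤ :=
  (S.finite_toSet.isCompact_convexHull ℝ).measure_lt_top.ne

theorem union_tile {S : Finset E} (hS : AntipProp (S : Set E)) :
    μ (⋃ s ∈ S, tile S s) = (S.card : ENNReal) * ENNReal.ofReal ((1/2 : ℝ) ^ finrank ℝ E)
      * μ (convexHull ℝ (S : Set E)) := by
  rw [measure_biUnion_finset₀ (tile_disj μ hS) (fun s _ => (tile_meas S s).nullMeasurableSet)]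
  have : ∀ s ∈ S, μ (tile S s) = ENNReal.ofReal ((1/2 : ℝ) ^ finrank ℝ E)
      * μ (convexHull ℝ (S : Set E)) := fun s _ => measure_half μ s _
  rw [Finset.sum_congr rfl this]
  simp [mul_assoc]

theorem card_mul_half (m n : ℕ) :
    (m : ENNReal) * ENNReal.ofReal ((1/2 : ℝ) ^ n) = ENNReal.ofReal (m / 2 ^ n) := by
  rw [← ENNReal.ofReal_natCast, ← ENNReal.ofReal_mul (by positivity)]
  congr 1
  simp [div_eq_mul_inv]

theorem card_le_of_interior {S : Finset E} (hS : AntipProp (S : Set E))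
    (hi : (interior (convexHull ℝ (S : Set E))).Nonempty) : S.card ≤ 2 ^ finrank ℝ E := by
  borelize E
  have h1 := union_tile (Measure.addHaar : Measure E) hS
  have h2 : (Measure.addHaar : Measure E) (⋃ s ∈ S, tile S s)
      ≤ 1 * (Measure.addHaar : Measure E) (convexHull ℝ (S : Set E)) := by
    rw [one_mul]
    exact measure_mono (Set.iUnion₂_subset fun s hs => tile_subset hs)
  rw [h1, ENNReal.mul_le_mul_iff_left (hull_pos _ hi) (hull_fin _ S), card_mul_half,
    ENNReal.ofReal_le_one, div_le_one (by positivity)] at h2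
  exact_mod_cast h2

theorem cover_ae {S : Finset E} (hS : AntipProp (S : Set E))
    (hc : S.card = 2 ^ finrank ℝ E) :
    ∀ᵐ u ∂μ, u ∈ convexHull ℝ (S : Set E) → ∃ s ∈ S, (2:ℝ) • u - s ∈ convexHull ℝ (S : Set E) := by
  have h1 := union_tile μ hS
  rw [card_mul_half, hc] at h1
  simp only [Nat.cast_pow, Nat.cast_ofNat, ne_eq, pow_eq_zero_iff', OfNat.ofNat_ne_zero,
    false_and, not_false_eq_true, div_self, ENNReal.ofReal_one, one_mul] at h1
  have h3 := ae_eq_of_subset_of_measure_ge (μ := μ)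
    (Set.iUnion₂_subset fun s (hs : s ∈ S) => tile_subset hs) h1.ge
    (Finset.measurableSet_biUnion S (fun s _ => tile_meas S s)).nullMeasurableSet (hull_fin _ S)
  filter_upwards [h3.symm.le] with u hu hup
  have := hu hup
  change u ∈ (⋃ s ∈ S, tile S s) at this
  simpa [tile] using this

end Vol

section Face

variable {E : Type*} [NormedAddCommGroup E] [NormedSpace ℝ E] [FiniteDimensional ℝ E]
  [MeasurableSpace E] [BorelSpace E] (μ : Measure E) [μ.IsAddHaarMeasure]

theorem exists_gap {α : Type*} (T : Finset α) (g : α → ℝ) (c : ℝ) (h : ∀ z ∈ T, c < g z) :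
    ∃ δ > 0, ∀ z ∈ T, c + δ ≤ g z := by
  classical
  rcases T.eq_empty_or_nonempty with rfl | hT
  · exact ⟨1, one_pos, by simp⟩
  · obtain ⟨w, hw, hm⟩ := T.exists_min_image g hT
    exact ⟨g w - c, by linarith [h w hw], fun z hz => by linarith [hm z hz]⟩

theorem exists_q {P : Set E} (hP : Convex ℝ P) {o x y : E} (ho : o ∈ interior P)
    (hx : x ∈ P) (hy : y ∈ P) (f g : E →L[ℝ] ℝ) (hf1 : f y ≤ f o) (hf2 : f o ≤ f x)
    (hf : f y < f x) (hg : g x = g y) {δ : ℝ} (hδ : 0 < δ) :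
    ∃ q ∈ interior P, g q < g x + δ ∧ f q = (f x + f y) / 2 := by
  obtain ⟨l, hl0, hl1, hl2⟩ : ∃ l : ℝ, 0 < l ∧ l ≤ 1/4 ∧ l * (g o - g x) < δ := by
    refine ⟨min (1/4) (δ / (2 * (|g o - g x| + 1))), by positivity, min_le_left _ _, ?_⟩
    have h1 : min (1/4) (δ / (2 * (|g o - g x| + 1))) * (g o - g x) ≤
        δ / (2 * (|g o - g x| + 1)) * (|g o - g x| + 1) := by
      have : g o - g x ≤ |g o - g x| + 1 := by linarith [le_abs_self (g o - g x)]
      calc _ ≤ min (1/4) (δ / (2 * (|g o - g x| + 1))) * (|g o - g x| + 1) := by gcongr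
        _ ≤ _ := by gcongr; exact min_le_right _ _
    have h2 : δ / (2 * (|g o - g x| + 1)) * (|g o - g x| + 1) = δ / 2 := by
      field_simp
    linarith
  have hq1 := hP.combo_interior_self_mem_interior ho hx hl0 (b := 1 - l) (by linarith) (by ring)
  have hq2 := hP.combo_interior_self_mem_interior ho hy hl0 (b := 1 - l) (by linarith) (by ring)
  set q1 := l • o + (1 - l) • x with hq1d
  set q2 := l • o + (1 - l) • y with hq2d
  have f1 : f q1 = l * f o + (1 - l) * f x := by simp [hq1d]
  have f2 : f q2 = l * f o + (1 - l) * f y := by simp [hq2d]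
  have g1 : g q1 = l * g o + (1 - l) * g x := by simp [hq1d]
  have g2 : g q2 = l * g o + (1 - l) * g x := by simp [hq2d, hg]
  have k1 : (f x + f y) / 2 ≤ f q1 := by rw [f1]; nlinarith
  have k2 : f q2 ≤ (f x + f y) / 2 := by rw [f2]; nlinarith
  have k3 : f q2 < f q1 := by rw [f1, f2]; nlinarith
  have k4 : 0 < f q1 - f q2 := by linarith
  set θ := ((f x + f y) / 2 - f q2) / (f q1 - f q2) with hθ
  have t0 : 0 ≤ θ := div_nonneg (by linarith) k4.le
  have t1 : θ ≤ 1 := (div_le_one k4).2 (by linarith)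
  have t2 : θ * (f q1 - f q2) = (f x + f y) / 2 - f q2 := div_mul_cancel₀ _ k4.ne'
  refine ⟨θ • q1 + (1 - θ) • q2, hP.interior hq1 hq2 t0 (by linarith) (by ring), ?_, ?_⟩
  · simp only [map_add, map_smul, smul_eq_mul, g1, g2]
    nlinarith
  · simp only [map_add, map_smul, smul_eq_mul]
    linarith

/-- Slab of a ball. -/
def slab {E : Type*} [NormedAddCommGroup E] [NormedSpace ℝ E] (f : E →L[ℝ] ℝ) (q : E)
    (c t ρ : ℝ) : Set E := {u | u ∈ ball q ρ ∧ c < f u ∧ f u ≤ c + t}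

theorem slab_half (f : E →L[ℝ] ℝ) (q e : E) (he : f e = 1) (c t ρ : ℝ) (ht : 0 < t) :
    μ (slab f q c t ρ) ≤ 2 * μ (slab f q c (t/2) (ρ + t/2 * ‖e‖)) := by
  have hsub : slab f q c t ρ ⊆ slab f q c (t/2) (ρ + t/2 * ‖e‖) ∪
      (fun u => u + (-(t/2)) • e) ⁻¹' (slab f q c (t/2) (ρ + t/2 * ‖e‖)) := by
    rintro u ⟨h1, h2, h3⟩
    rw [mem_ball, dist_eq_norm] at h1
    have hn : 0 ≤ t / 2 * ‖e‖ := by positivity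
    by_cases h : f u ≤ c + t / 2
    · left
      exact ⟨by rw [mem_ball, dist_eq_norm]; linarith, h2, h⟩
    · right
      refine ⟨?_, ?_, ?_⟩
      · rw [mem_ball, dist_eq_norm]
        calc ‖u + (-(t/2)) • e - q‖ = ‖(u - q) + (-(t/2)) • e‖ := by congr 1; abel
          _ ≤ ‖u - q‖ + ‖(-(t/2)) • e‖ := norm_add_le _ _
          _ = ‖u - q‖ + t/2 * ‖e‖ := by
            rw [norm_smul, norm_neg, Real.norm_of_nonneg (by positivity)]
          _ < _ := by linarith
      · simp only [map_add, map_smul, smul_eq_mul, he]; linarith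
      · simp only [map_add, map_smul, smul_eq_mul, he]; linarith
  calc μ (slab f q c t ρ) ≤ _ := measure_mono hsub
    _ ≤ _ := measure_union_le _ _
    _ = _ := by rw [measure_preimage_add_right, two_mul]

theorem slab_pow (f : E →L[ℝ] ℝ) (q e : E) (he : f e = 1) (c : ℝ) (k : ℕ) :
    ∀ (t ρ : ℝ), 0 < t →
    μ (slab f q c t ρ) ≤ 2 ^ k * μ (slab f q c (t/2^k) (ρ + t * ‖e‖)) := by
  induction k with
  | zero =>
    intro t ρ ht
    simp only [pow_zero, one_mul, div_one]
    apply measure_mono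
    rintro u ⟨h1, h2, h3⟩
    exact ⟨ball_subset_ball (by nlinarith [norm_nonneg e]) h1, h2, h3⟩
  | succ k ih =>
    intro t ρ ht
    refine (slab_half μ f q e he c t ρ ht).trans ?_
    rw [pow_succ', mul_assoc]
    gcongr
    refine (ih (t/2) _ (by positivity)).trans (le_of_eq ?_)
    congr 3
    · rw [pow_succ', div_div]
    · ring

theorem face_card {S : Finset E} (hS : AntipProp (S : Set E))
    (hi : (interior (convexHull ℝ (S : Set E))).Nonempty)
    (hc : S.card = 2 ^ finrank ℝ E) {x y : E} (hx : x ∈ S) (hy : y ∈ S) (f g : E →L[ℝ] ℝ)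
    (hf : f y < f x) (hfS : ∀ z ∈ S, f y ≤ f z ∧ f z ≤ f x) (hg : g x = g y)
    (hgS : ∀ z ∈ S, z ≠ x → z ≠ y → g x < g z) :
    2 ^ finrank ℝ E ≤ 2 * (S.filter (fun z => f z = f y)).card := by
  classical
  set P := convexHull ℝ (S : Set E) with hPd
  have hPc : Convex ℝ P := convex_convexHull ℝ _
  have hSP : ∀ s ∈ S, s ∈ P := fun s hs => subset_convexHull ℝ _ hs
  obtain ⟨μ, hμ⟩ : ∃ μ : Measure E, μ.IsAddHaarMeasure := ⟨Measure.addHaar, inferInstance⟩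
  have hcov := cover_ae μ hS hc
  by_contra hcon
  push Not at hcon
  set m := (S.filter (fun z => f z = f y)).card with hm
  -- gaps
  obtain ⟨δ, hδ, hδS⟩ := exists_gap (S.filter (fun z => z ≠ x ∧ z ≠ y)) g (g x) (by
    intro z hz; simp only [Finset.mem_filter] at hz; exact hgS z hz.1 hz.2.1 hz.2.2)
  obtain ⟨γ, hγ, hγS⟩ := exists_gap (S.filter (fun z => f z ≠ f y)) f (f y) (by
    intro z hz; simp only [Finset.mem_filter] at hz
    exact lt_of_le_of_ne (hfS z hz.1).1 (Ne.symm hz.2))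
  have hgP : ∀ u ∈ P, g x ≤ g u := le_on_hull g (fun z hz => by
    by_cases h1 : z = x
    · rw [h1]
    by_cases h2 : z = y
    · rw [h2, hg]
    exact (hgS z hz h1 h2).le)
  have hfP1 : ∀ u ∈ P, f y ≤ f u := le_on_hull f (fun z hz => (hfS z hz).1)
  have hfP2 : ∀ u ∈ P, f u ≤ f x := hull_le f (fun z hz => (hfS z hz).2)
  obtain ⟨o, ho⟩ := hi
  obtain ⟨q, hq, hgq, hfq⟩ := exists_q hPc ho (hSP x hx) (hSP y hy) f g
    (hfP1 o (interior_subset ho)) (hfP2 o (interior_subset ho)) hf hg (half_pos hδ)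
  set c := (f x + f y) / 2 with hcd
  -- a ball
  obtain ⟨r, hr, hball⟩ : ∃ r > 0, ball q r ⊆ interior P ∩ {u | g u < g x + δ / 2} := by
    have ho : IsOpen (interior P ∩ {u | g u < g x + δ / 2}) :=
      isOpen_interior.inter (isOpen_lt g.continuous continuous_const)
    exact Metric.isOpen_iff.1 ho q ⟨hq, hgq⟩
  set e : E := (f x - f y)⁻¹ • (x - y) with hed
  have he : f e = 1 := by
    rw [hed, map_smul, map_sub, smul_eq_mul, inv_mul_cancel₀ (by linarith)]
  obtain ⟨t0, ht0, ht1, ht2⟩ : ∃ t0 : ℝ, 0 < t0 ∧ t0 * ‖e‖ ≤ r / 2 ∧ 2 * t0 < γ := by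
    refine ⟨min (r / 2 / (‖e‖ + 1)) (γ / 4), by positivity, ?_, ?_⟩
    · calc _ ≤ r / 2 / (‖e‖ + 1) * (‖e‖ + 1) := by
            gcongr
            · exact min_le_left _ _
            · linarith
        _ = r / 2 := by field_simp
    · have := min_le_right (r / 2 / (‖e‖ + 1)) (γ / 4)
      linarith
  let L : ℝ → Set E := fun t => {u | u ∈ P ∧ f u ≤ f y + t}
  set K := ENNReal.ofReal ((1/2 : ℝ) ^ finrank ℝ E) with hK
  -- slab into low part
  have step2 : ∀ t, μ (slab f q c t r) ≤ K * μ (L (2 * t)) := by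
    intro t
    rw [hK, ← measure_half μ x]
    apply measure_mono_ae
    filter_upwards [hcov] with u hu
    rintro ⟨h1, h2, h3⟩
    obtain ⟨h4, h5⟩ := hball h1
    obtain ⟨s, hs, hsu⟩ := hu (interior_subset h4)
    have h6 := hgP _ hsu
    have h7 := hfP1 _ hsu
    have h8 := hfP2 _ hsu
    change g u < _ at h5
    simp only [map_sub, map_smul, smul_eq_mul] at h6 h7 h8
    have hsx : s = x := by
      by_contra hsx
      by_cases hsy : s = y
      · subst hsy
        linarith
      · have := hδS s (by simp [hs, hsx, hsy])
        linarith
    subst hsx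
    refine ⟨hsu, ?_⟩
    simp only [map_sub, map_smul, smul_eq_mul]
    linarith
  -- self similarity
  have step4 : ∀ t, t < γ → μ (L (t / 2)) ≤ m * K * μ (L t) := by
    intro t ht
    have : μ (L (t/2)) ≤ μ (⋃ s ∈ S.filter (fun z => f z = f y), {u | (2:ℝ) • u - s ∈ L t}) := by
      apply measure_mono_ae
      filter_upwards [hcov] with u hu
      rintro ⟨h1, h2⟩
      obtain ⟨s, hs, hsu⟩ := hu h1
      have h7 := hfP1 _ hsu
      simp only [map_sub, map_smul, smul_eq_mul] at h7
      have hsy : f s = f y := by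
        by_contra hsy
        have := hγS s (by simp [hs, hsy])
        linarith
      refine Set.mem_biUnion (x := s) (by simp [hs, hsy]) ⟨hsu, ?_⟩
      simp only [map_sub, map_smul, smul_eq_mul]
      linarith
    refine this.trans ((measure_biUnion_finset_le _ _).trans ?_)
    simp only [measure_half]
    simp [hm, hK, mul_assoc]
  have step5 : ∀ k : ℕ, μ (L (2 * (t0 / 2 ^ k))) ≤ (m * K) ^ k * μ P := by
    intro k
    induction k with
    | zero =>
      simp only [pow_zero, one_mul]
      exact measure_mono (fun u hu => hu.1)
    | succ k ih =>
      have h1 : 2 * (t0 / 2 ^ (k+1)) = (2 * (t0 / 2 ^ k)) / 2 := by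
        rw [pow_succ]; ring
      rw [h1]
      refine (step4 _ ?_).trans ?_
      · have : t0 / 2 ^ k ≤ t0 := div_le_self ht0.le (one_le_pow₀ (by norm_num))
        linarith
      · rw [pow_succ', mul_assoc (↑m * K)]
        gcongr
  have step6 : ∀ k : ℕ, μ (slab f q c t0 (r/2)) ≤ (2 * (m * K)) ^ k * (K * μ P) := by
    intro k
    calc μ (slab f q c t0 (r/2)) ≤ 2 ^ k * μ (slab f q c (t0/2^k) (r/2 + t0 * ‖e‖)) :=
          slab_pow μ f q e he c k t0 _ ht0
      _ ≤ 2 ^ k * μ (slab f q c (t0/2^k) r) := by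
          gcongr
          rintro u ⟨h1, h2⟩
          exact ⟨ball_subset_ball (by linarith) h1, h2⟩
      _ ≤ 2 ^ k * (K * ((m * K) ^ k * μ P)) := by
          gcongr
          exact (step2 _).trans (by gcongr; exact step5 k)
      _ = _ := by rw [mul_pow]; ring
  have hlt : 2 * (m * K) < 1 := by
    have : (2 : ENNReal) * (m * K) = ENNReal.ofReal (((2 * m : ℕ) : ℝ) / 2 ^ finrank ℝ E) := by
      rw [← card_mul_half, ← hK]; push_cast; ring
    rw [this, ENNReal.ofReal_lt_one, div_lt_one (by positivity)]
    exact_mod_cast hcon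
  have htend : Filter.Tendsto (fun k : ℕ => (2 * (m * K)) ^ k * (K * μ P)) Filter.atTop
      (nhds (0 * (K * μ P))) := by
    apply ENNReal.Tendsto.mul_const (ENNReal.tendsto_pow_atTop_nhds_zero_of_lt_one hlt)
    right
    exact ENNReal.mul_ne_top ENNReal.ofReal_ne_top (hull_fin μ S)
  rw [zero_mul] at htend
  have hz := ge_of_tendsto' htend step6
  have hpos : 0 < μ (ball q (r/2) ∩ {u | c < f u ∧ f u < c + t0}) := by
    apply IsOpen.measure_pos
    · exact isOpen_ball.inter ((isOpen_lt continuous_const f.continuous).inter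
        (isOpen_lt f.continuous continuous_const))
    · refine ⟨q + (t0/2) • e, ?_, ?_, ?_⟩
      · rw [mem_ball, dist_eq_norm, add_sub_cancel_left, norm_smul,
          Real.norm_of_nonneg (by positivity)]
        linarith
      · simp [he, hfq, ht0]
      · simp [he, hfq, ht0]
  have : μ (ball q (r/2) ∩ {u | c < f u ∧ f u < c + t0}) ≤ μ (slab f q c t0 (r/2)) :=
    measure_mono (fun u hu => ⟨hu.1, hu.2.1, hu.2.2.le⟩)
  exact absurd (hpos.trans_le (this.trans hz)) (lt_irrefl _)

end Face

section Main

theorem exists_edge {E : Type*} [NormedAddCommGroup E] [InnerProductSpace ℝ E]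
    {S : Finset E} (hS : AntipProp (S : Set E)) (hc : 2 ≤ S.card) :
    ∃ x ∈ S, ∃ y ∈ S, x ≠ y ∧ ∃ g : E →L[ℝ] ℝ, g x = g y ∧
      ∀ z ∈ S, z ≠ x → z ≠ y → g x < g z := by
  classical
  obtain ⟨x, hx⟩ : S.Nonempty := Finset.card_pos.1 (by omega)
  have hch : ∀ y : E, ∃ f : E →L[ℝ] ℝ, y ∈ S → x ≠ y →
      1 ≤ f x - f y ∧ ∀ z ∈ S, f y ≤ f z ∧ f z ≤ f x := by
    intro y
    by_cases h : y ∈ S ∧ x ≠ y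
    · obtain ⟨f, -, h1, h2⟩ := hS x hx y h.1 h.2
      exact ⟨f, fun _ _ => ⟨h1, h2⟩⟩
    · exact ⟨0, fun h1 h2 => absurd ⟨h1, h2⟩ h⟩
  choose φ hφ using hch
  set T := S.erase x with hT
  have hTm : ∀ z, z ∈ T ↔ z ≠ x ∧ z ∈ S := fun z => Finset.mem_erase
  let F : E →L[ℝ] ℝ := ∑ z ∈ T, φ z
  have hFa : ∀ u, F u = ∑ z ∈ T, φ z u := fun u => by simp [F]
  have hF : ∀ z ∈ T, 0 < F x - F z := by
    intro z hz
    rw [sub_pos, hFa, hFa]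
    apply Finset.sum_lt_sum
    · intro i hi
      have hi' := (hTm i).1 hi
      exact ((hφ i hi'.2 hi'.1.symm).2 z ((hTm z).1 hz).2).2
    · refine ⟨z, hz, ?_⟩
      have hi' := (hTm z).1 hz
      linarith [(hφ z hi'.2 hi'.1.symm).1]
  let w : E → E := fun z => (F x - F z)⁻¹ • (z - x)
  have hw : ∀ z ∈ T, z - x = (F x - F z) • w z := by
    intro z hz
    simp only [w]
    rw [smul_inv_smul₀ (hF z hz).ne']
  have key : ∀ z ∈ T, ∀ z' ∈ T, F x - F z < F x - F z' → w z = w z' → False := by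
    intro z hz z' hz' hlt hww
    obtain ⟨f, -, h1, h2⟩ := hS z ((hTm z).1 hz).2 x hx ((hTm z).1 hz).1
    have h3 := (h2 z' ((hTm z').1 hz').2).2
    have e1 := congrArg f (hw z hz)
    have e2 := congrArg f (hw z' hz')
    rw [← hww] at e2
    simp only [map_sub, map_smul, smul_eq_mul] at e1 e2 h1 hlt
    have hD := hF z hz
    have : 0 < f (w z) := by
      by_contra hneg
      push Not at hneg
      nlinarith
    nlinarith
  have hinj : ∀ z ∈ T, ∀ z' ∈ T, w z = w z' → z = z' := by
    intro z hz z' hz' hww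
    rcases lt_trichotomy (F x - F z) (F x - F z') with h | h | h
    · exact (key z hz z' hz' h hww).elim
    · have e1 := hw z hz
      rw [h, hww, ← hw z' hz'] at e1
      exact sub_left_injective e1
    · exact (key z' hz' z hz h hww.symm).elim
  have hTne : T.Nonempty := by
    apply Finset.card_pos.1
    rw [hT, Finset.card_erase_of_mem hx]
    omega
  obtain ⟨y, hy, hmax⟩ := T.exists_max_image (fun z => ‖w z‖) hTne
  have hy' := (hTm y).1 hy
  let g : E →L[ℝ] ℝ := -(innerSL ℝ (w y)) - (‖w y‖ ^ 2) • F
  have hg : ∀ z ∈ T, g z - g x = (F x - F z) * (‖w y‖ ^ 2 - inner ℝ (w y) (w z)) := by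
    intro z hz
    have h1 : g z - g x = - inner ℝ (w y) (z - x) + ‖w y‖ ^ 2 * (F x - F z) := by
      simp only [g, ContinuousLinearMap.sub_apply, ContinuousLinearMap.neg_apply, innerSL_apply_apply,
        ContinuousLinearMap.smul_apply, smul_eq_mul, inner_sub_right]
      ring
    rw [h1, hw z hz, inner_smul_right]
    ring
  refine ⟨x, hx, y, hy'.2, hy'.1.symm, g, ?_, ?_⟩
  · have := hg y hy
    rw [real_inner_self_eq_norm_sq, sub_self, mul_zero] at this
    linarith
  · intro z hz hzx hzy
    have hzT := (hTm z).2 ⟨hzx, hz⟩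
    have hne : w y - w z ≠ 0 := fun h => hzy (hinj z hzT y hy (sub_eq_zero.1 h).symm)
    have h1 := norm_sub_sq_real (w y) (w z)
    have h2 : 0 < ‖w y - w z‖ ^ 2 := by positivity
    have h3 : ‖w z‖ ^ 2 ≤ ‖w y‖ ^ 2 := by
      gcongr
      exact hmax z hzT
    have h4 := hg z hzT
    have h5 : 0 < (F x - F z) * (‖w y‖ ^ 2 - inner ℝ (w y) (w z)) :=
      mul_pos (hF z hzT) (by linarith)
    linarith

theorem transfer {E : Type*} [NormedAddCommGroup E] [InnerProductSpace ℝ E]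
    {S : Finset E} (hS : AntipProp (S : Set E)) (W : Submodule ℝ E) {s0 : E}
    (h : ∀ x ∈ S, x - s0 ∈ W) :
    ∃ S' : Finset W, AntipProp (S' : Set W) ∧ S'.card = S.card ∧
      ∑ x ∈ S', ∑ y ∈ S', ‖x - y‖ ^ 2 = ∑ x ∈ S, ∑ y ∈ S, ‖x - y‖ ^ 2 := by
  classical
  let j : W ↪ E := ⟨fun v => (v : E) + s0, fun a b hab => by simpa using hab⟩
  have hj : ∀ a, j a = (a : E) + s0 := fun _ => rfl
  let S' : Finset W := S.preimage j j.injective.injOn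
  have hmem : ∀ a, a ∈ S' ↔ j a ∈ S := fun a => by simp [S']
  have hmap : S'.map j = S := by
    ext u
    simp only [Finset.mem_map, hmem]
    constructor
    · rintro ⟨a, ha, rfl⟩; exact ha
    · intro hu
      have : j ⟨u - s0, h u hu⟩ = u := by simp [hj]
      exact ⟨_, by rw [this]; exact hu, this⟩
  refine ⟨S', ?_, ?_, ?_⟩
  · intro x hx y hy hxy
    obtain ⟨f, h0, h1, h2⟩ := hS (j x) ((hmem x).1 hx) (j y) ((hmem y).1 hy) (fun hh => hxy (j.injective hh))
    refine ⟨f.comp W.subtypeL, ?_, ?_, ?_⟩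
    · refine ContinuousLinearMap.opNorm_le_bound _ zero_le_one (fun v => ?_)
      calc ‖f (v : E)‖ ≤ ‖f‖ * ‖(v : E)‖ := f.le_opNorm _
        _ ≤ 1 * ‖v‖ := by gcongr; rfl
    · simp only [hj, map_add] at h1
      simp only [ContinuousLinearMap.comp_apply, Submodule.subtypeL_apply]
      linarith
    · intro z hz
      have := h2 (j z) ((hmem z).1 hz)
      simp only [hj, map_add] at this
      simp only [ContinuousLinearMap.comp_apply, Submodule.subtypeL_apply]
      constructor <;> linarith [this.1, this.2]
  · rw [← hmap, Finset.card_map]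
  · conv_rhs => rw [← hmap]
    simp only [Finset.sum_map, hj, add_sub_add_right_eq_sub]
    rfl

theorem sum_sq_expand {E : Type*} [NormedAddCommGroup E] [InnerProductSpace ℝ E] (A B : Finset E) :
    ∑ x ∈ A, ∑ y ∈ B, ‖x - y‖ ^ 2 = B.card * ∑ x ∈ A, ‖x‖ ^ 2 + A.card * ∑ y ∈ B, ‖y‖ ^ 2
      - 2 * inner ℝ (∑ x ∈ A, x) (∑ y ∈ B, y) := by
  simp only [norm_sub_sq_real, Finset.sum_add_distrib, Finset.sum_sub_distrib, Finset.sum_const,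
    nsmul_eq_mul, sum_inner, inner_sum, Finset.mul_sum]
  rw [Finset.sum_comm (s := B) (t := A)]
  ring

theorem main_ind (n : ℕ) : ∀ (E : Type) [NormedAddCommGroup E] [InnerProductSpace ℝ E]
    [FiniteDimensional ℝ E], finrank ℝ E = n → ∀ S : Finset E, AntipProp (S : Set E) →
    S.card ≤ 2 ^ n ∧ (S.card = 2 ^ n →
      (2 ^ n : ℝ) ^ 2 * n / 2 ≤ ∑ x ∈ S, ∑ y ∈ S, ‖x - y‖ ^ 2) := by
  induction n using Nat.strong_induction_on with
  | _ n ih =>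
  intro E _ _ _ hE S hS
  classical
  rcases S.eq_empty_or_nonempty with rfl | hne
  · refine ⟨by simp, fun h => ?_⟩
    have : 0 < 2 ^ n := by positivity
    simp only [Finset.card_empty] at h
    omega
  by_cases hV : vectorSpan ℝ (S : Set E) = ⊤
  swap
  · have hlt : finrank ℝ (vectorSpan ℝ (S : Set E)) < n := by
      rw [← hE]
      exact Submodule.finrank_lt hV
    obtain ⟨s0, hs0⟩ := hne
    obtain ⟨S', h1, h2, -⟩ := transfer hS (vectorSpan ℝ (S : Set E)) (s0 := s0)
      (fun x hx => vsub_mem_vectorSpan ℝ hx hs0)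
    have h3 := (ih _ hlt (vectorSpan ℝ (S : Set E)) rfl S' h1).1
    have h4 : 2 ^ finrank ℝ (vectorSpan ℝ (S : Set E)) < 2 ^ n :=
      Nat.pow_lt_pow_right (by norm_num) hlt
    exact ⟨by omega, fun h => by omega⟩
  have hi : (interior (convexHull ℝ (S : Set E))).Nonempty := by
    rw [interior_convexHull_nonempty_iff_affineSpan_eq_top]
    exact (AffineSubspace.affineSpan_eq_top_iff_vectorSpan_eq_top_of_nonempty ℝ E E
      (Finset.coe_nonempty.2 hne)).2 hV
  borelize E
  refine ⟨hE ▸ card_le_of_interior hS hi, fun hc => ?_⟩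
  rcases n with _ | n
  · simp only [pow_zero, CharP.cast_eq_zero, mul_zero, zero_div]
    positivity
  have h2 : 2 ≤ S.card := by
    rw [hc, pow_succ]
    have : 0 < 2 ^ n := by positivity
    omega
  obtain ⟨x, hx, y, hy, hxy, g, hg, hgS⟩ := exists_edge hS h2
  obtain ⟨f, hf0, hf1, hfS⟩ := hS x hx y hy hxy
  rw [← hE] at hc
  have c1 := face_card hS hi hc hx hy f g (by linarith) hfS hg hgS
  have c2 := face_card hS hi hc hy hx (-f) g (by simp; linarith)
    (fun z hz => by simpa using (hfS z hz).symm) hg.symm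
    (fun z hz h1 h2 => hg ▸ hgS z hz h2 h1)
  rw [hE] at c1 c2 hc
  set A := S.filter (fun z => f z = f y) with hA
  set B := S.filter (fun z => (-f) z = (-f) x) with hB
  have mA : ∀ z, z ∈ A ↔ z ∈ S ∧ f z = f y := fun z => by simp [hA]
  have mB : ∀ z, z ∈ B ↔ z ∈ S ∧ f z = f x := fun z => by simp [hB]
  have hdisj : Disjoint A B := by
    rw [Finset.disjoint_left]
    intro z h1 h2
    linarith [((mA z).1 h1).2, ((mB z).1 h2).2]
  have hsub : A ∪ B ⊆ S := Finset.union_subset (Finset.filter_subset _ _) (Finset.filter_subset _ _)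
  have hcu := Finset.card_union_of_disjoint hdisj
  have hle := Finset.card_le_card hsub
  have hpw : 2 ^ (n+1) = 2 * 2 ^ n := pow_succ' 2 n
  have hSeq : A ∪ B = S := Finset.eq_of_subset_of_card_le hsub (by omega)
  have hcA : A.card = 2 ^ n := by omega
  have hcB : B.card = 2 ^ n := by omega
  have hker : finrank ℝ f.toLinearMap.ker = n := by
    have hr := LinearMap.finrank_range_add_finrank_ker f.toLinearMap
    have hsurj : f.toLinearMap.range = ⊤ := by
      apply LinearMap.range_eq_top.2
      apply LinearMap.surjective
      intro h0
      have := congrArg (fun l : E →ₗ[ℝ] ℝ => l (x - y)) h0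
      simp only [ContinuousLinearMap.coe_coe, map_sub, LinearMap.zero_apply] at this
      linarith
    rw [hsurj, finrank_top, finrank_self, hE] at hr
    omega
  have half : ∀ (C : Finset E) (v : E), C ⊆ S → (∀ z ∈ C, f z = f v) → C.card = 2 ^ n →
      (2 ^ n : ℝ) ^ 2 * n / 2 ≤ ∑ x ∈ C, ∑ y ∈ C, ‖x - y‖ ^ 2 := by
    intro C v hCS hCv hCc
    have hCa : AntipProp (C : Set E) := by
      intro a ha b hb hab
      obtain ⟨f, p1, p2, p3⟩ := hS a (hCS ha) b (hCS hb) hab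
      exact ⟨f, p1, p2, fun z hz => p3 z (hCS hz)⟩
    obtain ⟨S', q1, q2, q3⟩ := transfer hCa f.toLinearMap.ker (s0 := v)
      (fun z hz => by simp [hCv z hz])
    have := (ih n (by omega) _ hker S' q1).2 (by omega)
    rwa [q3] at this
  have hVA := half A y (Finset.filter_subset _ _) (fun z hz => ((mA z).1 hz).2) hcA
  have hVB := half B x (Finset.filter_subset _ _) (fun z hz => ((mB z).1 hz).2) hcB
  have hab : (2 ^ n : ℝ) ≤ ‖∑ z ∈ B, z - ∑ z ∈ A, z‖ := by
    have e1 : f (∑ z ∈ B, z - ∑ z ∈ A, z) = 2 ^ n * (f x - f y) := by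
      rw [map_sub, map_sum, map_sum, Finset.sum_congr rfl (fun z hz => ((mA z).1 hz).2),
        Finset.sum_congr rfl (fun z hz => ((mB z).1 hz).2)]
      simp [hcA, hcB]
      ring
    have e2 := f.le_opNorm (∑ z ∈ B, z - ∑ z ∈ A, z)
    rw [e1] at e2
    have e3 := le_abs_self (2 ^ n * (f x - f y))
    rw [← Real.norm_eq_abs] at e3
    have e4 : (0:ℝ) < 2 ^ n := by positivity
    have e5 := norm_nonneg (∑ z ∈ B, z - ∑ z ∈ A, z)
    nlinarith
  have hab2 : (2 ^ n : ℝ) ^ 2 ≤ ‖∑ z ∈ B, z - ∑ z ∈ A, z‖ ^ 2 := by gcongr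
  rw [norm_sub_sq_real] at hab2
  rw [sum_sq_expand, hcA, real_inner_self_eq_norm_sq] at hVA
  rw [sum_sq_expand, hcB, real_inner_self_eq_norm_sq] at hVB
  rw [sum_sq_expand, hc, real_inner_self_eq_norm_sq, ← hSeq, Finset.sum_union hdisj,
    Finset.sum_union hdisj, norm_add_sq_real]
  have hcomm := real_inner_comm (∑ z ∈ A, z) (∑ z ∈ B, z)
  push_cast at hVA hVB ⊢
  rw [pow_succ (2:ℝ) n]
  generalize (2 ^ n : ℝ) = N at *
  linarith

end Main

section Final

theorem norm_rpow_eq {n : ℕ} {p : ℝ} (hp2 : 2 ≤ p) [Fact (1 ≤ ENNReal.ofReal p)]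
    (v : PiLp (ENNReal.ofReal p) (fun _ : Fin n => ℝ)) : ‖v‖ ^ p = ∑ i, |v i| ^ p := by
  have hp : (ENNReal.ofReal p).toReal = p := ENNReal.toReal_ofReal (by linarith)
  rw [PiLp.norm_eq_sum (by rw [hp]; linarith), hp, ← Real.rpow_mul (by positivity),
    one_div, inv_mul_cancel₀ (by linarith), Real.rpow_one]
  rfl

theorem sum_rpow_le {n : ℕ} {p : ℝ} (hp2 : 2 ≤ p) (v : Fin n → ℝ) {N : ℝ} (hN : 0 ≤ N)
    (h : ∑ i, v i ^ 2 = N ^ 2) : ∑ i, |v i| ^ p ≤ N ^ p := by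
  have h1 : ∀ i, |v i| ≤ N := by
    intro i
    apply abs_le_of_sq_le_sq _ hN
    rw [← h]
    exact Finset.single_le_sum (f := fun i => v i ^ 2) (fun _ _ => sq_nonneg _) (Finset.mem_univ i)
  have e : ∀ x : ℝ, 0 ≤ x → x ^ p = x ^ 2 * x ^ (p - 2) := by
    intro x hx
    rw [← Real.rpow_two, ← Real.rpow_add_of_nonneg hx (by norm_num) (by linarith)]
    congr 1; ring
  rw [e N hN, ← h, Finset.sum_mul]
  apply Finset.sum_le_sum
  intro i _
  rw [e _ (abs_nonneg _), sq_abs]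
  have := Real.rpow_le_rpow (abs_nonneg _) (h1 i) (show 0 ≤ p - 2 by linarith)
  gcongr

theorem no_big (n : ℕ) (hn : 4 ≤ n) (p : ℝ) (hp2 : 2 ≤ p)
    (hplog : p < Real.logb 2 n) [Fact (1 ≤ ENNReal.ofReal p)]
    (S : Finset (PiLp (ENNReal.ofReal p) (fun _ : Fin n => ℝ)))
    (hs : (S : Set (PiLp (ENNReal.ofReal p) (fun _ : Fin n => ℝ))) ⊆ sphere 0 1)
    (hS : AntipProp (S : Set (PiLp (ENNReal.ofReal p) (fun _ : Fin n => ℝ)))) :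
    S.card < 2 ^ n := by
  classical
  by_contra hcon
  push Not at hcon
  obtain ⟨S1, hS1, hc1⟩ := Finset.exists_subset_card_eq hcon
  let T : EuclideanSpace ℝ (Fin n) ≃ₗ[ℝ] PiLp (ENNReal.ofReal p) (fun _ : Fin n => ℝ) :=
    (WithLp.linearEquiv 2 ℝ (Fin n → ℝ)).trans
      (WithLp.linearEquiv (ENNReal.ofReal p) ℝ (Fin n → ℝ)).symm
  have hT : ∀ v i, T v i = v i := fun v i => rfl
  have hTs : ∀ v i, T.symm v i = v i := fun v i => rfl
  have hTn : ∀ v, ‖T v‖ ≤ ‖v‖ := by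
    intro v
    rw [← Real.rpow_le_rpow_iff (norm_nonneg _) (norm_nonneg _) (show 0 < p by linarith),
      norm_rpow_eq hp2]
    simp only [hT]
    apply sum_rpow_le hp2 _ (norm_nonneg _)
    rw [EuclideanSpace.norm_sq_eq]
    simp
  let S2 : Finset (EuclideanSpace ℝ (Fin n)) := S1.map T.symm.toEquiv.toEmbedding
  have mS2 : ∀ v, v ∈ S2 ↔ T v ∈ S1 := by
    intro v
    simp only [S2, Finset.mem_map]
    constructor
    · rintro ⟨a, ha, rfl⟩
      simpa using ha
    · intro h
      exact ⟨_, h, by simp⟩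
  have hS2 : AntipProp (S2 : Set (EuclideanSpace ℝ (Fin n))) := by
    intro x hx y hy hxy
    obtain ⟨f, h0, h1, h2⟩ := hS (T x) (hS1 ((mS2 x).1 hx)) (T y) (hS1 ((mS2 y).1 hy))
      (fun h => hxy (T.injective h))
    refine ⟨f.comp (LinearMap.toContinuousLinearMap T.toLinearMap), ?_, ?_, ?_⟩
    · refine ContinuousLinearMap.opNorm_le_bound _ zero_le_one (fun v => ?_)
      calc ‖f (T v)‖ ≤ ‖f‖ * ‖T v‖ := f.le_opNorm _
        _ ≤ 1 * ‖v‖ := by gcongr; exact hTn v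
    · exact h1
    · intro z hz
      exact h2 (T z) (hS1 ((mS2 z).1 hz))
  have hc2 : S2.card = 2 ^ n := by simp [S2, hc1]
  have hmain := (main_ind n (EuclideanSpace ℝ (Fin n)) (by simp) S2 hS2).2 hc2
  rw [sum_sq_expand, real_inner_self_eq_norm_sq, hc2] at hmain
  have hn0 : (0:ℝ) < n := by exact_mod_cast (by omega : 0 < n)
  have hpn : (2:ℝ) ^ p < n := by
    rwa [← Real.lt_logb_iff_rpow_lt (by norm_num) hn0]
  have hlt : ∀ x ∈ S2, ‖x‖ ^ 2 < n / 4 := by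
    intro x hx
    by_contra hge
    push Not at hge
    have h1 : ‖T x‖ = 1 := by simpa using hs (hS1 ((mS2 x).1 hx))
    have h2 := norm_rpow_eq hp2 (T x)
    rw [h1, Real.one_rpow] at h2
    have h3 := Real.rpow_sum_le_const_mul_sum_rpow (Finset.univ) (fun i => x i ^ 2)
      (p := p / 2) (by linarith)
    have h4 : ∑ i, |x i ^ 2| = ‖x‖ ^ 2 := by
      rw [EuclideanSpace.norm_sq_eq]; simp
    have h5 : ∑ i, |x i ^ 2| ^ (p / 2) = 1 := by
      rw [h2]
      refine Finset.sum_congr rfl (fun i _ => ?_)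
      rw [hT, abs_pow, ← Real.rpow_two, ← Real.rpow_mul (abs_nonneg _)]
      congr 1; ring
    rw [h4, h5, mul_one, Finset.card_univ, Fintype.card_fin] at h3
    have h6 : ((n:ℝ) / 4) ^ (p/2) ≤ (n:ℝ) ^ (p/2 - 1) :=
      (Real.rpow_le_rpow (by positivity) hge (by linarith)).trans h3
    have h7 : (4:ℝ) ^ (p/2) = 2 ^ p := by
      rw [show (4:ℝ) = 2 ^ (2:ℝ) by norm_num, ← Real.rpow_mul (by norm_num)]
      congr 1; ring
    rw [Real.div_rpow hn0.le (by norm_num), h7, Real.rpow_sub_one hn0.ne'] at h6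
    have h8 : 0 < (n:ℝ) ^ (p/2) := by positivity
    have h9 : (n:ℝ) ^ (p/2) / n < (n:ℝ) ^ (p/2) / 2 ^ p := by gcongr
    linarith
  have hsum : ∑ x ∈ S2, ‖x‖ ^ 2 < ∑ x ∈ S2, (n:ℝ) / 4 := by
    apply Finset.sum_lt_sum_of_nonempty _ hlt
    apply Finset.card_pos.1
    rw [hc2]; positivity
  rw [Finset.sum_const, hc2, nsmul_eq_mul] at hsum
  push_cast at hsum hmain
  have hN : (0:ℝ) < 2 ^ n := by positivity
  have := sq_nonneg ‖∑ x ∈ S2, x‖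
  nlinarith

/-- The sign of a boolean. -/
def sg (b : Bool) : ℝ := if b then 1 else -1

/-- The points of the prism over the cross-polytope. -/
def pt (p : ℝ) (m : ℕ) (s : Fin m × Bool × Bool) :
    PiLp (ENNReal.ofReal p) (fun _ : Fin (m + 1) => ℝ) :=
  WithLp.toLp _ (Fin.cons (sg s.2.2 * (1/3) ^ (1/p))
    (fun j => if j = s.1 then sg s.2.1 * (2/3) ^ (1/p) else 0) : Fin (m + 1) → ℝ)

theorem pt_zero (p : ℝ) (m : ℕ) (s : Fin m × Bool × Bool) :
    pt p m s 0 = sg s.2.2 * (1/3) ^ (1/p) := rfl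

theorem pt_succ (p : ℝ) (m : ℕ) (s : Fin m × Bool × Bool) (j : Fin m) :
    pt p m s j.succ = if j = s.1 then sg s.2.1 * (2/3) ^ (1/p) else 0 := rfl

theorem abs_sg (b : Bool) : |sg b| = 1 := by cases b <;> simp [sg]

theorem pt_norm (p : ℝ) (hp2 : 2 ≤ p) [Fact (1 ≤ ENNReal.ofReal p)] (m : ℕ)
    (s : Fin m × Bool × Bool) : ‖pt p m s‖ = 1 := by
  have hp0 : p ≠ 0 := by linarith
  have h := norm_rpow_eq hp2 (pt p m s)
  rw [Fin.sum_univ_succ, Finset.sum_eq_single s.1] at h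
  · rw [pt_zero, pt_succ, if_pos rfl, abs_mul, abs_mul, abs_sg, abs_sg, one_mul, one_mul,
      abs_of_nonneg (by positivity), abs_of_nonneg (by positivity), ← Real.rpow_mul (by norm_num),
      ← Real.rpow_mul (by norm_num), one_div_mul_cancel hp0] at h
    norm_num at h
    rw [← Real.one_rpow p] at h
    exact (Real.rpow_left_inj (norm_nonneg _) zero_le_one hp0).1 h
  · intro b _ hb
    rw [pt_succ, if_neg hb, abs_zero, Real.zero_rpow hp0]
  · simp

theorem two_coord {n : ℕ} {p : ℝ} (hp2 : 2 ≤ p) [Fact (1 ≤ ENNReal.ofReal p)]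
    (v : PiLp (ENNReal.ofReal p) (fun _ : Fin n => ℝ)) {i j : Fin n} (hij : i ≠ j) :
    2 ^ (1/p - 1) * (|v i| + |v j|) ≤ ‖v‖ := by
  have hp0 : p ≠ 0 := by linarith
  rw [← Real.rpow_le_rpow_iff (by positivity) (norm_nonneg _) (show 0 < p by linarith),
      norm_rpow_eq hp2, Real.mul_rpow (by positivity) (by positivity),
      ← Real.rpow_mul (by norm_num)]
  have h1 := Real.rpow_sum_le_const_mul_sum_rpow {i, j} v (p := p) (by linarith)
  rw [Finset.sum_pair hij, Finset.sum_pair hij, Finset.card_pair hij] at h1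
  have h2 : |v i| ^ p + |v j| ^ p ≤ ∑ i, |v i| ^ p := by
    rw [← Finset.sum_pair (f := fun i => |v i| ^ p) hij]
    exact Finset.sum_le_sum_of_subset_of_nonneg (Finset.subset_univ _) (fun _ _ _ => by positivity)
  refine le_trans ?_ h2
  calc (2:ℝ) ^ ((1/p - 1) * p) * (|v i| + |v j|) ^ p
      ≤ (2:ℝ) ^ ((1/p - 1) * p) * (((2:ℕ):ℝ) ^ (p - 1) * (|v i| ^ p + |v j| ^ p)) := by gcongr
    _ = _ := by
      push_cast
      rw [← mul_assoc, ← Real.rpow_add (by norm_num)]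
      have : (1/p - 1) * p + (p - 1) = 0 := by field_simp; ring
      rw [this, Real.rpow_zero, one_mul]

theorem pt_sep (p : ℝ) (hp2 : 2 ≤ p) [Fact (1 ≤ ENNReal.ofReal p)] (m : ℕ)
    (s t : Fin m × Bool × Bool) (hst : s ≠ t) :
    ∃ f : PiLp (ENNReal.ofReal p) (fun _ : Fin (m + 1) => ℝ) →L[ℝ] ℝ, ‖f‖ ≤ 1 ∧
      1 < f (pt p m s) - f (pt p m t) ∧
      ∀ z, f (pt p m t) ≤ f (pt p m z) ∧ f (pt p m z) ≤ f (pt p m s) := by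
  have hp0 : 0 < p := by linarith
  have hmu : (1/2 : ℝ) < (1/3) ^ (1/p) := by
    rw [← Real.rpow_lt_rpow_iff (by norm_num) (by positivity) hp0, ← Real.rpow_mul (by norm_num),
      one_div_mul_cancel hp0.ne', Real.rpow_one]
    have := Real.rpow_le_rpow_of_exponent_ge (x := 1/2) (by norm_num) (by norm_num) hp2
    norm_num at this ⊢
    linarith
  have hla : (1/3 : ℝ) ^ (1/p) ≤ (2/3) ^ (1/p) :=
    Real.rpow_le_rpow (by norm_num) (by norm_num) (by positivity)
  have hla2 : 1 < 2 ^ (1/p - 1) * (2 * (2/3 : ℝ) ^ (1/p)) := by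
    have : 2 ^ (1/p - 1) * (2 * (2/3 : ℝ) ^ (1/p)) = (4/3 : ℝ) ^ (1/p) := by
      rw [Real.rpow_sub_one (by norm_num)]
      rw [show (4/3 : ℝ) = 2 * (2/3) by norm_num, Real.mul_rpow (by norm_num) (by norm_num)]
      ring
    rw [this]
    exact Real.one_lt_rpow (by norm_num) (by positivity)
  obtain ⟨i, a, b⟩ := s
  obtain ⟨j, a', b'⟩ := t
  let pr (k : Fin (m+1)) := PiLp.proj (𝕜 := ℝ) (ENNReal.ofReal p) (fun _ : Fin (m + 1) => ℝ) k
  have hpr : ∀ k v, pr k v = v k := fun k v => rfl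
  have hK : (0:ℝ) < 2 ^ (1/p - 1) := by positivity
  by_cases hb : b = b'
  · by_cases hij : i = j
    · have ha : a ≠ a' := by rintro rfl; subst hb hij; exact hst rfl
      subst hb hij
      refine ⟨sg a • pr i.succ, ?_, ?_, ?_⟩
      · refine ContinuousLinearMap.opNorm_le_bound _ zero_le_one (fun v => ?_)
        rw [ContinuousLinearMap.smul_apply, hpr, norm_smul, Real.norm_eq_abs, abs_sg, one_mul,
          one_mul]
        exact PiLp.norm_apply_le v _
      · simp only [ContinuousLinearMap.smul_apply, hpr, pt_succ, smul_eq_mul]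
        cases a <;> cases a' <;> simp [sg] at ha ⊢ <;> norm_num at hla hmu ⊢ <;> linarith
      · rintro ⟨k, c, d⟩
        simp only [ContinuousLinearMap.smul_apply, hpr, pt_succ, smul_eq_mul]
        have hl0 : (0:ℝ) ≤ (2/3) ^ (1/p) := by positivity
        cases a <;> cases a' <;> cases c <;> split_ifs <;>
          simp only [sg, if_true, Bool.false_eq_true, if_false, ne_eq, not_true_eq_false] at ha ⊢ <;>
          (constructor <;> linarith)
    · have hji : j ≠ i := Ne.symm hij
      refine ⟨(2:ℝ) ^ (1/p - 1) • (sg a • pr i.succ - sg a' • pr j.succ), ?_, ?_, ?_⟩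
      · refine ContinuousLinearMap.opNorm_le_bound _ zero_le_one (fun v => ?_)
        rw [ContinuousLinearMap.smul_apply, norm_smul, Real.norm_of_nonneg hK.le, one_mul]
        refine le_trans ?_ (two_coord hp2 v (i := i.succ) (j := j.succ) (by simpa using hij))
        gcongr
        simp only [ContinuousLinearMap.sub_apply, ContinuousLinearMap.smul_apply, hpr]
        refine (norm_sub_le _ _).trans (le_of_eq ?_)
        simp [abs_sg]
      · simp only [ContinuousLinearMap.smul_apply, ContinuousLinearMap.sub_apply, hpr, pt_succ,
          smul_eq_mul, hij, hji, if_true, if_false]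
        cases a <;> cases a' <;> simp only [sg, if_true, Bool.false_eq_true, if_false] <;> linarith
      · rintro ⟨k, c, d⟩
        simp only [ContinuousLinearMap.smul_apply, ContinuousLinearMap.sub_apply, hpr, pt_succ,
          smul_eq_mul, hij, hji, if_true, if_false]
        constructor
        · apply mul_le_mul_of_nonneg_left _ hK.le
          cases a <;> cases a' <;> cases c <;> simp only [sg, if_true, Bool.false_eq_true, if_false]
            <;> split_ifs <;> first | linarith | (exfalso; simp_all)
        · apply mul_le_mul_of_nonneg_left _ hK.le
          cases a <;> cases a' <;> cases c <;> simp only [sg, if_true, Bool.false_eq_true, if_false]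
            <;> split_ifs <;> first | linarith | (exfalso; simp_all)
  · refine ⟨sg b • pr 0, ?_, ?_, ?_⟩
    · refine ContinuousLinearMap.opNorm_le_bound _ zero_le_one (fun v => ?_)
      rw [ContinuousLinearMap.smul_apply, hpr, norm_smul, Real.norm_eq_abs, abs_sg, one_mul,
        one_mul]
      exact PiLp.norm_apply_le v _
    · simp only [ContinuousLinearMap.smul_apply, hpr, pt_zero, smul_eq_mul]
      cases b <;> cases b' <;> simp [sg] at hb ⊢ <;> norm_num at hla hmu ⊢ <;> linarith
    · rintro ⟨k, c, d⟩
      simp only [ContinuousLinearMap.smul_apply, hpr, pt_zero, smul_eq_mul]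
      cases b <;> cases b' <;> cases d <;> simp only [sg, if_true, Bool.false_eq_true, if_false] at hb ⊢ <;>
          first | (exfalso; simp_all; done) | (constructor <;> linarith)

theorem lower_set (n : ℕ) (hn : 4 ≤ n) (p : ℝ) (hp2 : 2 ≤ p) [Fact (1 ≤ ENNReal.ofReal p)] :
    ∃ S : Finset (PiLp (ENNReal.ofReal p) (fun _ : Fin n => ℝ)), S.card = 4 * n - 4 ∧
      (S : Set (PiLp (ENNReal.ofReal p) (fun _ : Fin n => ℝ))) ⊆ sphere 0 1 ∧
      StrictAntipProp (S : Set (PiLp (ENNReal.ofReal p) (fun _ : Fin n => ℝ))) := by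
  classical
  obtain ⟨m, rfl⟩ : ∃ m, n = m + 1 := ⟨n - 1, by omega⟩
  have hinj : Function.Injective (pt p m) := by
    intro s t h
    by_contra hst
    obtain ⟨f, -, h1, -⟩ := pt_sep p hp2 m s t hst
    rw [h] at h1
    linarith
  refine ⟨Finset.univ.map ⟨pt p m, hinj⟩, ?_, ?_, ?_⟩
  · simp
    omega
  · intro v hv
    simp only [Finset.coe_map, Function.Embedding.coeFn_mk, Finset.coe_univ, Set.image_univ,
      Set.mem_range] at hv
    obtain ⟨s, rfl⟩ := hv
    simp [pt_norm p hp2]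
  · simp only [Finset.coe_map, Function.Embedding.coeFn_mk, Finset.coe_univ, Set.image_univ]
    rintro _ ⟨s, rfl⟩ _ ⟨t, rfl⟩ hst
    obtain ⟨f, h0, h1, h2⟩ := pt_sep p hp2 m s t (fun h => hst (by rw [h]))
    refine ⟨f, h0, h1, ?_⟩
    rintro _ ⟨z, rfl⟩
    exact h2 z

end Final

/-- For `n ≥ 4` and `2 ≤ p < log₂ n`, one has
`4n − 4 ≤ H'_α(ℓ_p^n) ≤ H_α(ℓ_p^n) < 2^n`; in particular no set of `2^n` points on the
unit sphere of `ℓ_p^n` is a bounded and separated antipodal set with constant `d ≥ 1`. -/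
theorem Halpha_lp_lt_of_lt_logb (n : ℕ) (hn : 4 ≤ n) (p : ℝ) (hp2 : 2 ≤ p)
    (hplog : p < Real.logb 2 n) [Fact (1 ≤ ENNReal.ofReal p)] :
    4 * n - 4 ≤ strictHalpha (PiLp (ENNReal.ofReal p) (fun _ : Fin n => ℝ)) ∧
    strictHalpha (PiLp (ENNReal.ofReal p) (fun _ : Fin n => ℝ)) ≤
      Halpha (PiLp (ENNReal.ofReal p) (fun _ : Fin n => ℝ)) ∧
    Halpha (PiLp (ENNReal.ofReal p) (fun _ : Fin n => ℝ)) < 2 ^ n ∧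
    ¬ ∃ S : Finset (PiLp (ENNReal.ofReal p) (fun _ : Fin n => ℝ)),
        S.card = 2 ^ n ∧
        (S : Set (PiLp (ENNReal.ofReal p) (fun _ : Fin n => ℝ))) ⊆ sphere 0 1 ∧
        ∃ d : ℝ, 1 ≤ d ∧
          IsBSA (S : Set (PiLp (ENNReal.ofReal p) (fun _ : Fin n => ℝ))) d := by
  have strict_imp : ∀ S : Finset (PiLp (ENNReal.ofReal p) (fun _ : Fin n => ℝ)),
      StrictAntipProp (S : Set (PiLp (ENNReal.ofReal p) (fun _ : Fin n => ℝ))) →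
      AntipProp (S : Set (PiLp (ENNReal.ofReal p) (fun _ : Fin n => ℝ))) := by
    intro S h x hx y hy hxy
    obtain ⟨f, h0, h1, h2⟩ := h x hx y hy hxy
    exact ⟨f, h0, h1.le, h2⟩
  have bd : BddAbove {k : ℕ | ∃ S : Finset (PiLp (ENNReal.ofReal p) (fun _ : Fin n => ℝ)),
      S.card = k ∧ (S : Set (PiLp (ENNReal.ofReal p) (fun _ : Fin n => ℝ))) ⊆ sphere 0 1 ∧
      AntipProp (S : Set (PiLp (ENNReal.ofReal p) (fun _ : Fin n => ℝ)))} := by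
    refine ⟨2 ^ n, ?_⟩
    rintro k ⟨S, rfl, h1, h2⟩
    exact (no_big n hn p hp2 hplog S h1 h2).le
  have hsub : {k : ℕ | ∃ S : Finset (PiLp (ENNReal.ofReal p) (fun _ : Fin n => ℝ)),
      S.card = k ∧ (S : Set (PiLp (ENNReal.ofReal p) (fun _ : Fin n => ℝ))) ⊆ sphere 0 1 ∧
      StrictAntipProp (S : Set (PiLp (ENNReal.ofReal p) (fun _ : Fin n => ℝ)))} ⊆
      {k : ℕ | ∃ S : Finset (PiLp (ENNReal.ofReal p) (fun _ : Fin n => ℝ)),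
      S.card = k ∧ (S : Set (PiLp (ENNReal.ofReal p) (fun _ : Fin n => ℝ))) ⊆ sphere 0 1 ∧
      AntipProp (S : Set (PiLp (ENNReal.ofReal p) (fun _ : Fin n => ℝ)))} := by
    rintro k ⟨S, h0, h1, h2⟩
    exact ⟨S, h0, h1, strict_imp S h2⟩
  have hlow := lower_set n hn p hp2
  refine ⟨?_, ?_, ?_, ?_⟩
  · exact le_csSup (bd.mono hsub) hlow
  · exact csSup_le_csSup bd ⟨_, hlow⟩ hsub
  · obtain ⟨S, h0, h1, h2⟩ := Nat.sSup_mem ⟨_, hsub hlow⟩ bd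
    have := no_big n hn p hp2 hplog S h1 h2
    rw [h0] at this
    exact this
  · rintro ⟨S, hc, hs, d, hd, -, h⟩
    have := no_big n hn p hp2 hplog S hs (by
      intro x hx y hy hxy
      obtain ⟨f, h0, h1, h2⟩ := h x hx y hy hxy
      exact ⟨f, h0, hd.trans h1, h2⟩)
    omega

end
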